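/- Let L₆ ∈ K[X,Y] be a homogeneous polynomial of degree 6 such that the plane sextic C : YZ⁵ + L₆(X,Y) = 0 is smooth and such that every element of Aut(C) ⊂ PGL₃(K) has order at most 5. Then Aut(C) is cyclic of order 5, generated by diag(1, 1, ζ₅). -/

import Mathlib

open MvPolynomial

/-- `GL₃(K)`: the group of invertible `3 × 3` matrices over `K`. -/
abbrev GL3 (K : Type*) [Field K] := (Matrix (Fin 3) (Fin 3) K)ˣ

/-- `PGL₃(K)`: the quotient of `GL₃(K)` by its center (the scalar matrices). -/
abbrev PGL3 (K : Type*) [Field K] := GL3 K ⧸ Subgroup.center (GL3 K)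

variable {K : Type*} [Field K]

/-- The substitution `F(X,Y,Z) ↦ F(A·(X,Y,Z)ᵗ)` for a `3 × 3` matrix `A`. -/
noncomputable def matAct (A : Matrix (Fin 3) (Fin 3) K) (F : MvPolynomial (Fin 3) K) :
    MvPolynomial (Fin 3) K :=
  aeval (fun i => ∑ j, C (A i j) * X j) F

lemma matAct_one (F : MvPolynomial (Fin 3) K) : matAct 1 F = F := by
  unfold matAct
  have h : (fun i => ∑ j, C ((1 : Matrix (Fin 3) (Fin 3) K) i j) * X j)
      = (X : Fin 3 → MvPolynomial (Fin 3) K) := by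
    funext i
    rw [Finset.sum_eq_single i]
    · simp
    · intro b _ hb
      simp [Matrix.one_apply, Ne.symm hb]
    · simp
  rw [h, aeval_X_left_apply]

lemma matAct_matAct (A B : Matrix (Fin 3) (Fin 3) K) (F : MvPolynomial (Fin 3) K) :
    matAct B (matAct A F) = matAct (A * B) F := by
  unfold matAct
  rw [← AlgHom.comp_apply, comp_aeval]
  have h : (fun i => (aeval fun i => ∑ j, C (B i j) * X j) (∑ j, C (A i j) * X j))
      = fun i => ∑ j : Fin 3, C ((A * B) i j) * (X j : MvPolynomial (Fin 3) K) := by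
    funext i
    simp only [map_sum, map_mul, aeval_C, aeval_X, algebraMap_eq, Finset.mul_sum]
    rw [Finset.sum_comm]
    refine Finset.sum_congr rfl fun k _ => ?_
    rw [Matrix.mul_apply, map_sum, Finset.sum_mul]
    refine Finset.sum_congr rfl fun j _ => ?_
    rw [map_mul, mul_assoc]
  rw [h]

lemma matAct_smul (A : Matrix (Fin 3) (Fin 3) K) (c : K) (F : MvPolynomial (Fin 3) K) :
    matAct A (c • F) = c • matAct A F :=
  map_smul (aeval fun i => ∑ j, C (A i j) * X j) c F

/-- The class of a matrix `A` in `PGL₃(K)` (junk value `1` if `A` is not invertible). -/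
noncomputable def pgl (A : Matrix (Fin 3) (Fin 3) K) : PGL3 K := by
  classical
  exact if h : IsUnit A then (QuotientGroup.mk h.unit : PGL3 K) else 1

/-- `F` defines a smooth plane sextic: `F` is homogeneous of degree `6`, and `F` together with
its partial derivatives have no common zero besides the origin. -/
def IsSmoothSextic (F : MvPolynomial (Fin 3) K) : Prop :=
  F.IsHomogeneous 6 ∧
    ∀ p : Fin 3 → K, eval p F = 0 → (∀ i, eval p (pderiv i F) = 0) → p = 0

/-- The automorphism group of the plane curve `F = 0`: the subgroup of `PGL₃(K)` consisting of
the classes of matrices `A ∈ GL₃(K)` with `F(A·(X,Y,Z)ᵗ) = λ·F(X,Y,Z)` for some `λ ∈ K×`. -/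
noncomputable def planeAut (F : MvPolynomial (Fin 3) K) : Subgroup (PGL3 K) where
  carrier := {g | ∃ A : GL3 K, (QuotientGroup.mk A : PGL3 K) = g ∧
    ∃ c : K, c ≠ 0 ∧ matAct (A : Matrix (Fin 3) (Fin 3) K) F = c • F}
  one_mem' := ⟨1, rfl, 1, one_ne_zero, by rw [Units.val_one, matAct_one, one_smul]⟩
  mul_mem' := by
    rintro g h ⟨A, rfl, c, hc, hA⟩ ⟨B, rfl, d, hd, hB⟩
    exact ⟨A * B, rfl, c * d, mul_ne_zero hc hd, by
      rw [Units.val_mul, ← matAct_matAct, hA, matAct_smul, hB, smul_smul]⟩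
  inv_mem' := by
    rintro g ⟨A, rfl, c, hc, hA⟩
    refine ⟨A⁻¹, rfl, c⁻¹, inv_ne_zero hc, ?_⟩
    rw [eq_inv_smul_iff₀ hc, ← matAct_smul, ← hA, matAct_matAct, ← Units.val_mul,
      mul_inv_cancel, Units.val_one, matAct_one]

open Matrix in
lemma eval_matAct (A : Matrix (Fin 3) (Fin 3) K) (F : MvPolynomial (Fin 3) K) (v : Fin 3 → K) :
    eval v (matAct A F) = eval (A *ᵥ v) F := by
  induction F using MvPolynomial.induction_on with
  | C a => simp [matAct]
  | add p q hp hq => simpa [matAct] using congrArg₂ (· + ·) hp hq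
  | mul_X p i hp =>
    have h : matAct A (p * X i) = matAct A p * ∑ j, C (A i j) * X j := by simp [matAct]
    rw [h, map_mul, hp]
    simp [mulVec, dotProduct]

lemma pderiv_matAct (A : Matrix (Fin 3) (Fin 3) K) (F : MvPolynomial (Fin 3) K) (j : Fin 3) :
    pderiv j (matAct A F) = ∑ i, C (A i j) * matAct A (pderiv i F) := by
  induction F using MvPolynomial.induction_on with
  | C a => simp [matAct]
  | add p q hp hq =>
    have h (p q : MvPolynomial (Fin 3) K) : matAct A (p + q) = matAct A p + matAct A q := by
      simp [matAct]
    simp only [h, map_add, hp, hq, mul_add, Finset.sum_add_distrib]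
  | mul_X p i hp =>
    have hX : pderiv j (∑ k, C (A i k) * X k : MvPolynomial (Fin 3) K) = C (A i j) := by
      simp [pderiv_X, Pi.single_apply]
    have h : matAct A (p * X i) = matAct A p * ∑ j, C (A i j) * X j := by simp [matAct]
    have h' (k : Fin 3) : matAct A (pderiv k (p * X i)) =
        matAct A (pderiv k p) * (∑ j, C (A i j) * X j) + matAct A p * if k = i then 1 else 0 := by
      rw [pderiv_mul]
      rcases eq_or_ne k i with rfl | hk
      · simp [matAct]
      · simp [matAct, hk, pderiv_X_of_ne hk.symm]
    rw [h, pderiv_mul, hX, hp]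
    simp only [h', mul_add, Finset.sum_add_distrib, Finset.sum_mul, mul_ite, mul_one, mul_zero,
      Finset.sum_ite_eq', Finset.mem_univ, if_true, mul_assoc]
    ring

section Semiinvariant

variable {A : Matrix (Fin 3) (Fin 3) K} {F : MvPolynomial (Fin 3) K} {c : K}

open Matrix in
lemma eval_mulVec_of_matAct_eq_smul (h : matAct A F = c • F) (v : Fin 3 → K) :
    eval (A *ᵥ v) F = c * eval v F := by
  rw [← eval_matAct, h, smul_eval]

open Matrix in
lemma sum_eval_pderiv_of_matAct_eq_smul (h : matAct A F = c • F) (v : Fin 3 → K) (j : Fin 3) :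
    ∑ i, A i j * eval (A *ᵥ v) (pderiv i F) = c * eval v (pderiv j F) := by
  have := congrArg (fun G => eval v (pderiv j G)) h
  simpa [pderiv_matAct, eval_matAct] using this

end Semiinvariant

/-- The sextic form `Y Z⁵ + L(X, Y)`. -/
noncomputable abbrev typeFiveSextic (L : MvPolynomial (Fin 2) K) : MvPolynomial (Fin 3) K :=
  X 1 * X 2 ^ 5 + rename (Fin.castSucc : Fin 2 → Fin 3) L

section Evaluation

variable (L : MvPolynomial (Fin 2) K) (x y z : K)

lemma eval_rename_castSucc : eval ![x, y, z] (rename (Fin.castSucc : Fin 2 → Fin 3) L)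
    = eval ![x, y] L := by
  rw [eval_rename]
  congr 2
  funext i
  fin_cases i <;> rfl

lemma eval_typeFiveSextic :
    eval ![x, y, z] (typeFiveSextic L) = y * z ^ 5 + eval ![x, y] L := by
  simp [typeFiveSextic, eval_rename_castSucc]

lemma eval_pderiv_zero_typeFiveSextic :
    eval ![x, y, z] (pderiv 0 (typeFiveSextic L)) = eval ![x, y] (pderiv 0 L) := by
  have h := pderiv_rename (Fin.castSucc_injective 2) 0 L
  rw [Fin.castSucc_zero] at h
  rw [typeFiveSextic, map_add, h, map_add, eval_rename_castSucc]
  simp [pderiv_X]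

lemma eval_pderiv_one_typeFiveSextic :
    eval ![x, y, z] (pderiv 1 (typeFiveSextic L)) = z ^ 5 + eval ![x, y] (pderiv 1 L) := by
  have h := pderiv_rename (Fin.castSucc_injective 2) 1 L
  rw [Fin.castSucc_one] at h
  rw [typeFiveSextic, map_add, h, map_add, eval_rename_castSucc]
  simp [pderiv_X]

lemma eval_pderiv_two_typeFiveSextic :
    eval ![x, y, z] (pderiv 2 (typeFiveSextic L)) = 5 * y * z ^ 4 := by
  have h : pderiv 2 (rename (Fin.castSucc : Fin 2 → Fin 3) L) = 0 := by
    classical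
    refine pderiv_eq_zero_of_notMem_vars fun hmem => ?_
    obtain ⟨i, -, hi⟩ := Finset.mem_image.mp (vars_rename _ L hmem)
    fin_cases i <;> simp [Fin.ext_iff] at hi
  rw [typeFiveSextic, map_add, h, add_zero]
  simp [pderiv_X]
  ring

end Evaluation

section BinaryForm

variable {L : MvPolynomial (Fin 2) K} {n : ℕ}

lemma MvPolynomial.IsHomogeneous.eval_smul {σ : Type*} {φ : MvPolynomial σ K}
    (h : φ.IsHomogeneous n) (t : K) (w : σ → K) : eval (t • w) φ = t ^ n * eval w φ := by
  simp only [eval_eq, Finset.mul_sum]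
  refine Finset.sum_congr rfl fun d hd => ?_
  have hdeg := h.degree_eq_sum_deg_support hd
  simp only [Pi.smul_apply, smul_eq_mul, mul_pow, Finset.prod_mul_distrib,
    Finset.prod_pow_eq_pow_sum, ← hdeg]
  ring

lemma MvPolynomial.IsHomogeneous.eval_mul_mul (h : L.IsHomogeneous n) (t x y : K) :
    eval ![t * x, t * y] L = t ^ n * eval ![x, y] L := by
  rw [← h.eval_smul]
  simp

lemma MvPolynomial.IsHomogeneous.euler_binary (h : L.IsHomogeneous n) (x y : K) :
    x * eval ![x, y] (pderiv 0 L) + y * eval ![x, y] (pderiv 1 L) = n * eval ![x, y] L := by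
  simpa using congrArg (eval ![x, y]) h.sum_X_mul_pderiv

variable [CharZero K]

/-- A binary form killed by a directional derivative is singular at that direction. -/
lemma MvPolynomial.IsHomogeneous.eval_pderiv_eq_zero_of_derivation_eq_zero
    (h : L.IsHomogeneous (n + 2)) {a b : K}
    (hab : ∀ x y, a * eval ![x, y] (pderiv 0 L) + b * eval ![x, y] (pderiv 1 L) = 0)
    (i : Fin 2) : eval ![a, b] (pderiv i L) = 0 := by
  have hpoly : C a * pderiv 0 L + C b * pderiv 1 L = 0 := by
    refine MvPolynomial.funext fun w => ?_
    have hw : w = ![w 0, w 1] := by funext i; fin_cases i <;> rfl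
    rw [hw]
    simpa using hab (w 0) (w 1)
  have hd := congrArg (fun p => eval ![a, b] (pderiv i p)) hpoly
  have hi : (pderiv i L).IsHomogeneous (n + 1) := by simpa using h.pderiv (i := i)
  have he := hi.euler_binary a b
  have hcomm (j : Fin 2) : pderiv i (pderiv j L) = pderiv j (pderiv i L) := by
    let D : Fin 2 → Derivation K (MvPolynomial (Fin 2) K) (MvPolynomial (Fin 2) K) := pderiv
    have : ⁅D i, D j⁆ = 0 := by
      refine MvPolynomial.derivation_ext fun k => ?_
      simp [D, Derivation.commutator_apply, pderiv_X, Pi.single_apply, apply_ite]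
    simpa [D, Derivation.commutator_apply, sub_eq_zero] using DFunLike.congr_fun this L
  simp only [map_add, pderiv_C_mul, map_mul, eval_C, map_zero, hcomm] at hd
  rw [hd] at he
  exact (mul_eq_zero.mp he.symm).resolve_left (by exact_mod_cast n.succ_ne_zero)

end BinaryForm

lemma eq_zero_of_forall_sum_mul_pow_eq_zero {R : Type*} [CommRing R] [IsDomain R] [Infinite R]
    {n : ℕ} {k : ℕ → R} (h : ∀ z, ∑ i ∈ Finset.range n, k i * z ^ i = 0) {i : ℕ} (hi : i < n) :
    k i = 0 := by
  have hp : (∑ i ∈ Finset.range n, Polynomial.C (k i) * Polynomial.X ^ i : Polynomial R) = 0 :=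
    Polynomial.funext fun z => by simpa [Polynomial.eval_finsetSum] using h z
  simpa [Polynomial.finsetSum_coeff, Polynomial.coeff_C_mul, Polynomial.coeff_X_pow, hi]
    using congrArg (fun p => Polynomial.coeff p i) hp

section Smooth

variable {L : MvPolynomial (Fin 2) K}

lemma eq_zero_of_isSmoothSextic [CharZero K] (hL : L.IsHomogeneous 6)
    (hsm : IsSmoothSextic (typeFiveSextic L)) {x y : K}
    (h0 : eval ![x, y] (pderiv 0 L) = 0) (h1 : eval ![x, y] (pderiv 1 L) = 0) :
    x = 0 ∧ y = 0 := by
  have he := hL.euler_binary x y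
  have hv : eval ![x, y] L = 0 := by simpa [h0, h1] using he.symm
  have h := hsm.2 ![x, y, 0] (by simp [eval_typeFiveSextic, hv]) fun i => by
    fin_cases i
    · simpa [h0] using eval_pderiv_zero_typeFiveSextic L x y 0
    · simpa [h1] using eval_pderiv_one_typeFiveSextic L x y 0
    · simpa using eval_pderiv_two_typeFiveSextic L x y 0
  exact ⟨congrFun h 0, congrFun h 1⟩

lemma eval_one_zero_ne_zero [IsAlgClosed K] (hL : L.IsHomogeneous 6)
    (hsm : IsSmoothSextic (typeFiveSextic L)) : eval ![1, 0] L ≠ 0 := by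
  intro h
  have he := hL.euler_binary 1 0
  have h0 : eval ![1, 0] (pderiv 0 L) = 0 := by simpa [h] using he
  obtain ⟨z, hz⟩ :=
    IsAlgClosed.exists_pow_nat_eq (-eval ![1, 0] (pderiv 1 L)) (n := 5) (by norm_num)
  have h := hsm.2 ![1, 0, z] (by simp [eval_typeFiveSextic, h]) fun i => by
    fin_cases i
    · simpa [h0] using eval_pderiv_zero_typeFiveSextic L 1 0 z
    · simpa [hz] using eval_pderiv_one_typeFiveSextic L 1 0 z
    · simpa using eval_pderiv_two_typeFiveSextic L 1 0 z
  exact one_ne_zero (congrFun h 0)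

end Smooth

open Matrix in
lemma mulVec_vec3 (A : Matrix (Fin 3) (Fin 3) K) (x y z : K) :
    A *ᵥ ![x, y, z] = ![A 0 0 * x + A 0 1 * y + A 0 2 * z,
      A 1 0 * x + A 1 1 * y + A 1 2 * z, A 2 0 * x + A 2 1 * y + A 2 2 * z] := by
  funext i
  fin_cases i <;> simp [mulVec, dotProduct, Fin.sum_univ_three]

open Matrix in
lemma eval_pderiv_mulVec_of_matAct_eq_smul {A B : Matrix (Fin 3) (Fin 3) K}
    {F : MvPolynomial (Fin 3) K} {c : K} (hAB : A * B = 1) (h : matAct A F = c • F)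
    (v : Fin 3 → K) (k : Fin 3) :
    eval (A *ᵥ v) (pderiv k F) = c * ∑ j, B j k * eval v (pderiv j F) := by
  have hk (i : Fin 3) : ∑ j, A i j * B j k = if i = k then 1 else 0 := by
    rw [← mul_apply, hAB, one_apply]
  calc eval (A *ᵥ v) (pderiv k F)
      = ∑ i, (∑ j, A i j * B j k) * eval (A *ᵥ v) (pderiv i F) := by simp [hk]
    _ = ∑ j, B j k * ∑ i, A i j * eval (A *ᵥ v) (pderiv i F) := by
        simp only [Finset.sum_mul, Finset.mul_sum]
        rw [Finset.sum_comm]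
        exact Finset.sum_congr rfl fun _ _ => Finset.sum_congr rfl fun _ _ => by ring
    _ = c * ∑ j, B j k * eval v (pderiv j F) := by
        rw [Finset.mul_sum]
        refine Finset.sum_congr rfl fun j _ => ?_
        rw [sum_eval_pderiv_of_matAct_eq_smul h]
        ring

section Shape

variable [CharZero K] {L : MvPolynomial (Fin 2) K}
  {A B : Matrix (Fin 3) (Fin 3) K} {c : K}

/-- Coefficients of `z` in the identity expressing `∂F/∂Z` at `A (x, y, z)` through the gradient
of `F = Y Z⁵ + L(X, Y)` at `(x, y, z)`; here `μ + m z` and `ψ + p z` are the last two coordinates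
of `A (x, y, z)`. -/
lemma coeff_identities {q₀ q₁ q₂ c y μ m ψ p P₀ P₁ : K}
    (h : ∀ z, 5 * (μ + m * z) * (ψ + p * z) ^ 4 =
      c * (q₀ * P₀ + q₁ * (z ^ 5 + P₁) + q₂ * (5 * y * z ^ 4))) :
    5 * μ * ψ ^ 4 = c * (q₀ * P₀ + q₁ * P₁) ∧
      4 * m * ψ ^ 3 * p + 6 * μ * ψ ^ 2 * p ^ 2 = 0 ∧
      6 * m * ψ ^ 2 * p ^ 2 + 4 * μ * ψ * p ^ 3 = 0 ∧
      4 * m * ψ * p ^ 3 + μ * p ^ 4 = c * q₂ * y ∧ 5 * m * p ^ 4 = c * q₁ := by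
  have h5 : (5 : K) ≠ 0 := by norm_num
  let k : ℕ → K := fun i => ![5 * μ * ψ ^ 4 - c * (q₀ * P₀ + q₁ * P₁),
    5 * (m * ψ ^ 4 + 4 * μ * ψ ^ 3 * p), 5 * (4 * m * ψ ^ 3 * p + 6 * μ * ψ ^ 2 * p ^ 2),
    5 * (6 * m * ψ ^ 2 * p ^ 2 + 4 * μ * ψ * p ^ 3),
    5 * (4 * m * ψ * p ^ 3 + μ * p ^ 4 - c * q₂ * y), 5 * m * p ^ 4 - c * q₁] (Fin.ofNat 6 i)
  have hk : ∀ z, ∑ i ∈ Finset.range 6, k i * z ^ i = 0 := fun z => by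
    simp only [Finset.sum_range_succ, Finset.sum_range_zero, k, Fin.ofNat]
    simp
    linear_combination h z
  have hk' := fun i (hi : i < 6) => eq_zero_of_forall_sum_mul_pow_eq_zero hk hi
  have h0 : 5 * μ * ψ ^ 4 - c * (q₀ * P₀ + q₁ * P₁) = 0 := hk' 0 (by norm_num)
  have h2 : 5 * (4 * m * ψ ^ 3 * p + 6 * μ * ψ ^ 2 * p ^ 2) = 0 := hk' 2 (by norm_num)
  have h3 : 5 * (6 * m * ψ ^ 2 * p ^ 2 + 4 * μ * ψ * p ^ 3) = 0 := hk' 3 (by norm_num)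
  have h4 : 5 * (4 * m * ψ * p ^ 3 + μ * p ^ 4 - c * q₂ * y) = 0 := hk' 4 (by norm_num)
  have h6 : 5 * m * p ^ 4 - c * q₁ = 0 := hk' 5 (by norm_num)
  exact ⟨sub_eq_zero.mp h0, (mul_eq_zero.mp h2).resolve_left h5,
    (mul_eq_zero.mp h3).resolve_left h5,
    sub_eq_zero.mp ((mul_eq_zero.mp h4).resolve_left h5), sub_eq_zero.mp h6⟩

lemma coeff_identities_of_matAct_eq_smul (hAB : A * B = 1)
    (h : matAct A (typeFiveSextic L) = c • typeFiveSextic L) (x y : K) :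
    let μ := A 1 0 * x + A 1 1 * y
    let ψ := A 2 0 * x + A 2 1 * y
    5 * μ * ψ ^ 4 =
        c * (B 0 2 * eval ![x, y] (pderiv 0 L) + B 1 2 * eval ![x, y] (pderiv 1 L)) ∧
      4 * A 1 2 * ψ ^ 3 * A 2 2 + 6 * μ * ψ ^ 2 * A 2 2 ^ 2 = 0 ∧
      6 * A 1 2 * ψ ^ 2 * A 2 2 ^ 2 + 4 * μ * ψ * A 2 2 ^ 3 = 0 ∧
      4 * A 1 2 * ψ * A 2 2 ^ 3 + μ * A 2 2 ^ 4 = c * B 2 2 * y ∧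
      5 * A 1 2 * A 2 2 ^ 4 = c * B 1 2 := by
  refine coeff_identities fun z => ?_
  have := eval_pderiv_mulVec_of_matAct_eq_smul hAB h ![x, y, z] 2
  simpa only [mulVec_vec3, Fin.sum_univ_three, eval_pderiv_zero_typeFiveSextic,
    eval_pderiv_one_typeFiveSextic, eval_pderiv_two_typeFiveSextic] using this

variable [IsAlgClosed K]

lemma apply_two_two_ne_zero (hL : L.IsHomogeneous 6)
    (hsm : IsSmoothSextic (typeFiveSextic L)) (hAB : A * B = 1) (hc : c ≠ 0)
    (h : matAct A (typeFiveSextic L) = c • typeFiveSextic L) : A 2 2 ≠ 0 := by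
  intro hp
  have h1 : B 1 2 = 0 := by
    obtain ⟨-, -, -, -, h5⟩ := coeff_identities_of_matAct_eq_smul hAB h 0 1
    simpa [hp, hc] using h5
  have h2 : B 2 2 = 0 := by
    obtain ⟨-, -, -, h4, -⟩ := coeff_identities_of_matAct_eq_smul hAB h 0 1
    simpa [hp, hc] using h4
  have hcol (i : Fin 3) : A i 0 * B 0 2 = if i = 2 then 1 else 0 := by
    have := congrFun (congrFun hAB i) 2
    simpa [Matrix.mul_apply, Fin.sum_univ_three, h1, h2, Matrix.one_apply] using this
  have hq : B 0 2 ≠ 0 := right_ne_zero_of_mul_eq_one (by simpa using hcol 2)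
  have h00 : A 0 0 = 0 := by simpa [hq] using hcol 0
  have h10 : A 1 0 = 0 := by simpa [hq] using hcol 1
  have he := eval_mulVec_of_matAct_eq_smul h ![1, 0, 0]
  rw [mulVec_vec3, eval_typeFiveSextic, eval_typeFiveSextic] at he
  have hz : eval ![0, 0] L = 0 := by simpa using hL.eval_mul_mul 0 0 0
  simp only [h00, h10, mul_zero, zero_mul, add_zero] at he
  refine eval_one_zero_ne_zero hL hsm ?_
  simpa [hz, hc] using he.symm

lemma last_row_eq_zero (hL : L.IsHomogeneous 6)
    (hsm : IsSmoothSextic (typeFiveSextic L)) (hAB : A * B = 1) (hc : c ≠ 0)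
    (h : matAct A (typeFiveSextic L) = c • typeFiveSextic L) :
    A 2 0 = 0 ∧ A 2 1 = 0 := by
  have hp := apply_two_two_ne_zero hL hsm hAB hc h
  have key (x y : K) (hψ : A 2 0 * x + A 2 1 * y ≠ 0) :
      A 1 2 = 0 ∧ A 1 0 * x + A 1 1 * y = 0 := by
    obtain ⟨-, h2, h3, -, -⟩ := coeff_identities_of_matAct_eq_smul hAB h x y
    set μ := A 1 0 * x + A 1 1 * y
    set ψ := A 2 0 * x + A 2 1 * y
    have h3' : 3 * A 1 2 * ψ + 2 * μ * A 2 2 = 0 := by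
      have : (2 * ψ * A 2 2 ^ 2) * (3 * A 1 2 * ψ + 2 * μ * A 2 2) = 0 := by
        linear_combination h3
      exact (mul_eq_zero.mp this).resolve_left (by simp [hψ, hp])
    have h2' : 2 * A 1 2 * ψ + 3 * μ * A 2 2 = 0 := by
      have : (2 * ψ ^ 2 * A 2 2) * (2 * A 1 2 * ψ + 3 * μ * A 2 2) = 0 := by
        linear_combination h2
      exact (mul_eq_zero.mp this).resolve_left (by simp [hψ, hp])
    have e1 : 5 * A 1 2 * ψ = 0 := by linear_combination 3 * h3' - 2 * h2'
    have e2 : 5 * μ * A 2 2 = 0 := by linear_combination 3 * h2' - 2 * h3'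
    exact ⟨by simpa [hψ] using e1, by simpa [hp] using e2⟩
  have hrow : ¬ (A 1 0 = 0 ∧ A 1 1 = 0 ∧ A 1 2 = 0) := fun ⟨h0, h1, h2⟩ => by
    have := congrFun (congrFun hAB 1) 1
    simp [Matrix.mul_apply, Fin.sum_univ_three, h0, h1, h2] at this
  by_contra hne
  refine hrow ?_
  by_cases h0 : A 2 0 = 0
  · have h1 : A 2 1 ≠ 0 := fun h1 => hne ⟨h0, h1⟩
    obtain ⟨hm, e1⟩ := key 0 1 (by simpa using h1)
    obtain ⟨-, e2⟩ := key 1 1 (by simpa [h0] using h1)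
    simp only [mul_zero, mul_one, zero_add] at e1 e2
    exact ⟨by simpa [e1] using e2, e1, hm⟩
  · obtain ⟨hm, e1⟩ := key 1 0 (by simpa using h0)
    simp only [mul_zero, mul_one, add_zero] at e1
    by_cases h1 : A 2 1 = 0
    · obtain ⟨-, e2⟩ := key 1 1 (by simpa [h1] using h0)
      exact ⟨e1, by simpa [e1] using e2, hm⟩
    · obtain ⟨-, e2⟩ := key 0 1 (by simpa using h1)
      exact ⟨e1, by simpa using e2, hm⟩

/-- An automorphism of `Y Z⁵ + L(X, Y) = 0` fixes the point `(0 : 0 : 1)`, the line `Z = 0` and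
the tangent line `Y = 0`. -/
lemma shape_of_matAct_eq_smul (hL : L.IsHomogeneous 6)
    (hsm : IsSmoothSextic (typeFiveSextic L)) (hAB : A * B = 1) (hc : c ≠ 0)
    (h : matAct A (typeFiveSextic L) = c • typeFiveSextic L) :
    A = !![A 0 0, A 0 1, 0; 0, A 1 1, 0; 0, 0, A 2 2] := by
  have hp := apply_two_two_ne_zero hL hsm hAB hc h
  obtain ⟨h20, h21⟩ := last_row_eq_zero hL hsm hAB hc h
  have hq := eq_zero_of_isSmoothSextic hL hsm (x := B 0 2) (y := B 1 2)
  have hd (x y : K) :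
      B 0 2 * eval ![x, y] (pderiv 0 L) + B 1 2 * eval ![x, y] (pderiv 1 L) = 0 := by
    obtain ⟨h1, -⟩ := coeff_identities_of_matAct_eq_smul hAB h x y
    simpa [h20, h21, hc] using h1.symm
  obtain ⟨hq0, hq1⟩ := hq (hL.eval_pderiv_eq_zero_of_derivation_eq_zero hd 0)
    (hL.eval_pderiv_eq_zero_of_derivation_eq_zero hd 1)
  have hcol (i : Fin 3) : A i 2 * B 2 2 = if i = 2 then 1 else 0 := by
    have := congrFun (congrFun hAB i) 2
    simpa [Matrix.mul_apply, Fin.sum_univ_three, hq0, hq1, Matrix.one_apply] using this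
  have hq2 : B 2 2 ≠ 0 := right_ne_zero_of_mul_eq_one (by simpa using hcol 2)
  have h02 : A 0 2 = 0 := by simpa [hq2] using hcol 0
  have h12 : A 1 2 = 0 := by simpa [hq2] using hcol 1
  have h10 : A 1 0 = 0 := by
    obtain ⟨-, -, -, h4, -⟩ := coeff_identities_of_matAct_eq_smul hAB h 1 0
    simpa [h12, hp] using h4
  ext i j
  fin_cases i <;> fin_cases j <;> simp [h20, h21, h02, h12, h10]

end Shape

section Relations

variable {L : MvPolynomial (Fin 2) K} {b k d e c : K}

lemma relations_of_matAct_eq_smul [IsAlgClosed K] (hL : L.IsHomogeneous 6)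
    (hsm : IsSmoothSextic (typeFiveSextic L))
    (h : matAct !![b, k, 0; 0, d, 0; 0, 0, e] (typeFiveSextic L) = c • typeFiveSextic L) :
    b ^ 6 = c ∧ d * e ^ 5 = c := by
  have hv (x y z : K) : d * y * (e * z) ^ 5 + eval ![b * x + k * y, d * y] L =
      c * (y * z ^ 5 + eval ![x, y] L) := by
    have := eval_mulVec_of_matAct_eq_smul h ![x, y, z]
    rw [mulVec_vec3, eval_typeFiveSextic, eval_typeFiveSextic] at this
    simpa using this
  constructor
  · have h1 := hv 1 0 0
    have h2 := hL.eval_mul_mul b 1 0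
    simp only [mul_zero, add_zero, zero_mul, zero_add] at h1 h2
    exact mul_right_cancel₀ (eval_one_zero_ne_zero hL hsm) (h2.symm.trans h1)
  · linear_combination hv 0 1 1 - hv 0 1 0

lemma pderiv_relations_of_matAct_eq_smul
    (h : matAct !![b, k, 0; 0, d, 0; 0, 0, e] (typeFiveSextic L) = c • typeFiveSextic L) (x y : K) :
    b * eval ![b * x + k * y, d * y] (pderiv 0 L) = c * eval ![x, y] (pderiv 0 L) ∧
      k * eval ![b * x + k * y, d * y] (pderiv 0 L) + d * eval ![b * x + k * y, d * y] (pderiv 1 L)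
        = c * eval ![x, y] (pderiv 1 L) := by
  constructor
  · have := sum_eval_pderiv_of_matAct_eq_smul h ![x, y, 0] 0
    rw [mulVec_vec3, Fin.sum_univ_three, eval_pderiv_zero_typeFiveSextic,
      eval_pderiv_zero_typeFiveSextic] at this
    simpa using this
  · have := sum_eval_pderiv_of_matAct_eq_smul h ![x, y, 0] 1
    rw [mulVec_vec3, Fin.sum_univ_three, eval_pderiv_zero_typeFiveSextic,
      eval_pderiv_one_typeFiveSextic, eval_pderiv_one_typeFiveSextic] at this
    simpa using this

variable [CharZero K]

lemma shear_eq_zero_of_matAct_eq_smul [IsAlgClosed K] (hL : L.IsHomogeneous 6)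
    (hsm : IsSmoothSextic (typeFiveSextic L)) (hb : b ≠ 0)
    (h : matAct !![b, k, 0; 0, b, 0; 0, 0, e] (typeFiveSextic L) = c • typeFiveSextic L) :
    k = 0 := by
  obtain ⟨rfl, -⟩ := relations_of_matAct_eq_smul hL hsm h
  have h1 := (pderiv_relations_of_matAct_eq_smul h 1 0).2
  have hP (i : Fin 2) := (show (pderiv i L).IsHomogeneous 5 by
    simpa using hL.pderiv (i := i)).eval_mul_mul b 1 0
  have he := hL.euler_binary 1 0
  simp only [mul_zero, add_zero, zero_mul, one_mul] at h1 hP he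
  rw [hP, hP, he] at h1
  have h0 : k * (b ^ 5 * (6 * eval ![1, 0] L)) = 0 := by
    push_cast at h1
    linear_combination h1
  simpa [hb, eval_one_zero_ne_zero hL hsm] using h0

lemma eq_or_eq_of_matAct_eq_smul (hL : L.IsHomogeneous 6)
    (hsm : IsSmoothSextic (typeFiveSextic L)) (hbd : b ≠ d)
    (h : matAct !![b, k, 0; 0, d, 0; 0, 0, e] (typeFiveSextic L) = c • typeFiveSextic L) :
    d ^ 6 = c ∨ b * d ^ 5 = c := by
  by_contra! hne
  have hdb : d - b ≠ 0 := sub_ne_zero.mpr hbd.symm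
  set u := k / (d - b) with hu
  have hfix : b * u + k * 1 = d * u := by rw [hu]; field_simp; ring
  have hv : eval ![u, 1] L = 0 := by
    have := eval_mulVec_of_matAct_eq_smul h ![u, 1, 0]
    rw [mulVec_vec3, eval_typeFiveSextic, eval_typeFiveSextic] at this
    have hs := hL.eval_mul_mul d u 1
    have : eval ![d * u, d * 1] L = c * eval ![u, 1] L := by
      rw [← hfix]
      simpa using this
    rw [hs] at this
    have h0 : (d ^ 6 - c) * eval ![u, 1] L = 0 := by linear_combination this
    exact (mul_eq_zero.mp h0).resolve_left (sub_ne_zero.mpr hne.1)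
  have h0 : eval ![u, 1] (pderiv 0 L) = 0 := by
    have hs := (show (pderiv 0 L).IsHomogeneous 5 by
      simpa using hL.pderiv (i := 0)).eval_mul_mul d u 1
    have := (pderiv_relations_of_matAct_eq_smul h u 1).1
    rw [hfix, hs] at this
    have h0 : (b * d ^ 5 - c) * eval ![u, 1] (pderiv 0 L) = 0 := by linear_combination this
    exact (mul_eq_zero.mp h0).resolve_left (sub_ne_zero.mpr hne.2)
  have he := hL.euler_binary u 1
  have h1 : eval ![u, 1] (pderiv 1 L) = 0 := by simpa [hv, h0] using he
  exact one_ne_zero (eq_zero_of_isSmoothSextic hL hsm h0 h1).2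

end Relations

section ProjectiveClasses

lemma pgl_val (A : GL3 K) : pgl (A : Matrix (Fin 3) (Fin 3) K) = (QuotientGroup.mk A : PGL3 K) := by
  rw [pgl, dif_pos A.isUnit, IsUnit.unit_of_val_units]

lemma mk_eq_one_iff {A : GL3 K} : (QuotientGroup.mk A : PGL3 K) = 1 ↔
    ∃ t, (A : Matrix (Fin 3) (Fin 3) K) = Matrix.scalar (Fin 3) t := by
  rw [QuotientGroup.eq_one_iff]
  refine Matrix.GeneralLinearGroup.mem_center_iff_val_mem_range_scalar.trans ?_
  simp only [Set.mem_range, eq_comm]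

lemma mk_eq_mk_of_eq_smul {A B : GL3 K} {t : K}
    (h : (A : Matrix (Fin 3) (Fin 3) K) = t • (B : Matrix (Fin 3) (Fin 3) K)) :
    (QuotientGroup.mk A : PGL3 K) = QuotientGroup.mk B := by
  rw [← inv_mul_eq_one, ← QuotientGroup.mk_inv, ← QuotientGroup.mk_mul, ← inv_eq_one,
    ← QuotientGroup.mk_inv, mk_eq_one_iff]
  refine ⟨t, ?_⟩
  rw [mul_inv_rev, inv_inv, Units.val_mul, h, mul_smul_comm, ← Units.val_mul, inv_mul_cancel]
  ext i j
  simp [Matrix.one_apply, Matrix.diagonal_apply]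

/-- The matrix with eigenvectors `(1, 0, 0)`, `(u, 1, 0)`, `(0, 0, 1)` and eigenvalues
`b`, `d`, `e`. -/
def eigenMatrix (u b d e : K) : Matrix (Fin 3) (Fin 3) K :=
  !![b, u * (d - b), 0; 0, d, 0; 0, 0, e]

lemma eigenMatrix_mul (u b d e b' d' e' : K) : eigenMatrix u b d e * eigenMatrix u b' d' e' =
    eigenMatrix u (b * b') (d * d') (e * e') := by
  ext i j
  fin_cases i <;> fin_cases j <;>
    simp [eigenMatrix, Matrix.mul_apply, Fin.sum_univ_three]
  ring

lemma eigenMatrix_pow (u b d e : K) (n : ℕ) :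
    eigenMatrix u b d e ^ n = eigenMatrix u (b ^ n) (d ^ n) (e ^ n) := by
  induction n with
  | zero =>
    ext i j
    fin_cases i <;> fin_cases j <;> simp [eigenMatrix]
  | succ n ih => rw [pow_succ, ih, eigenMatrix_mul, pow_succ, pow_succ, pow_succ]

lemma mk_pow_eq_one_iff {A : GL3 K} {u b d e : K}
    (hA : (A : Matrix (Fin 3) (Fin 3) K) = eigenMatrix u b d e) (n : ℕ) :
    (QuotientGroup.mk A : PGL3 K) ^ n = 1 ↔ b ^ n = d ^ n ∧ e ^ n = d ^ n := by
  rw [← QuotientGroup.mk_pow, mk_eq_one_iff, Units.val_pow_eq_pow_val, hA, eigenMatrix_pow]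
  constructor
  · rintro ⟨t, ht⟩
    have h (i : Fin 3) := congrFun (congrFun ht i) i
    have h0 : b ^ n = t := by simpa [eigenMatrix] using h 0
    have h1 : d ^ n = t := by simpa [eigenMatrix] using h 1
    have h2 : e ^ n = t := by simpa [eigenMatrix] using h 2
    exact ⟨h0.trans h1.symm, h2.trans h1.symm⟩
  · rintro ⟨h0, h2⟩
    refine ⟨d ^ n, ?_⟩
    ext i j
    fin_cases i <;> fin_cases j <;> simp [eigenMatrix, h0, h2]

/-- If `5` divides every exponent killing the class of an eigenmatrix, and that class has finite
order at most `5`, then its fifth power is trivial. -/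
lemma pow_five_eq_of_orderOf_le {A : GL3 K} {u b d e : K}
    (hA : (A : Matrix (Fin 3) (Fin 3) K) = eigenMatrix u b d e)
    (hord : orderOf (QuotientGroup.mk A : PGL3 K) ≤ 5) {N : ℕ} (hN : 0 < N)
    (hbN : b ^ N = d ^ N) (heN : e ^ N = d ^ N)
    (hdvd : ∀ n, b ^ n = d ^ n → e ^ n = d ^ n → 5 ∣ n) : b ^ 5 = d ^ 5 ∧ e ^ 5 = d ^ 5 := by
  have hpos : 0 < orderOf (QuotientGroup.mk A : PGL3 K) :=
    orderOf_pos_iff.mpr (isOfFinOrder_iff_pow_eq_one.mpr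
      ⟨N, hN, (mk_pow_eq_one_iff hA N).mpr ⟨hbN, heN⟩⟩)
  obtain ⟨h1, h2⟩ := (mk_pow_eq_one_iff hA _).mp (pow_orderOf_eq_one (QuotientGroup.mk A : PGL3 K))
  have h5 := Nat.le_antisymm hord (Nat.le_of_dvd hpos (hdvd _ h1 h2))
  rw [h5] at h1 h2
  exact ⟨h1, h2⟩

end ProjectiveClasses

lemma matAct_homology {ζ : K} [Infinite K] (hζ : ζ ^ 5 = 1) (L : MvPolynomial (Fin 2) K) :
    matAct !![1, 0, 0; 0, 1, 0; 0, 0, ζ] (typeFiveSextic L) = typeFiveSextic L := by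
  refine MvPolynomial.funext fun v => ?_
  have hv : v = ![v 0, v 1, v 2] := by funext i; fin_cases i <;> rfl
  rw [hv, eval_matAct, mulVec_vec3, eval_typeFiveSextic, eval_typeFiveSextic]
  simp [mul_pow, hζ]

/-- An automorphism of `Y Z⁵ + L(X, Y) = 0` has no eigenvalues `b ≠ d` on the line `Z = 0` when all
automorphisms have order at most `5`. -/
lemma eigenvalues_eq_of_orderOf_le [CharZero K] [IsAlgClosed K] {ζ : K} (hζ : IsPrimitiveRoot ζ 5)
    {L : MvPolynomial (Fin 2) K} (hL : L.IsHomogeneous 6)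
    (hsm : IsSmoothSextic (typeFiveSextic L))
    (hord : ∀ g ∈ planeAut (typeFiveSextic L), orderOf g ≤ 5) {S : GL3 K}
    (hS : (S : Matrix (Fin 3) (Fin 3) K) = !![1, 0, 0; 0, 1, 0; 0, 0, ζ])
    (hSmem : (QuotientGroup.mk S : PGL3 K) ∈ planeAut (typeFiveSextic L))
    {A : GL3 K} {b k d e c : K}
    (hA : (A : Matrix (Fin 3) (Fin 3) K) = !![b, k, 0; 0, d, 0; 0, 0, e]) (hc : c ≠ 0)
    (h : matAct (A : Matrix (Fin 3) (Fin 3) K) (typeFiveSextic L) = c • typeFiveSextic L) :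
    b = d := by
  by_contra hbd
  have hmem : (QuotientGroup.mk A : PGL3 K) ∈ planeAut (typeFiveSextic L) := ⟨A, rfl, c, hc, h⟩
  rw [hA] at h
  obtain ⟨hb6, hde⟩ := relations_of_matAct_eq_smul hL hsm h
  have hd : d ≠ 0 := left_ne_zero_of_mul (hde.trans_ne hc)
  have he : e ≠ 0 := fun h0 => hc (by rw [← hde, h0]; ring)
  have hdb : d - b ≠ 0 := sub_ne_zero.mpr (Ne.symm hbd)
  have hA' : (A : Matrix (Fin 3) (Fin 3) K) = eigenMatrix (k / (d - b)) b d e := by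
    rw [hA, eigenMatrix, div_mul_cancel₀ _ hdb]
  rcases eq_or_eq_of_matAct_eq_smul hL hsm hbd h with hd6 | hbd5
  · have hb6' : b ^ 6 = d ^ 6 := hb6.trans hd6.symm
    have he5 : e ^ 5 = d ^ 5 :=
      mul_left_cancel₀ hd (by rw [hde, ← hd6]; ring)
    obtain ⟨m, -, hm⟩ := hζ.eq_pow_of_pow_eq_one (ξ := d * ζ / e) (by
      rw [div_pow, mul_pow, hζ.pow_eq_one, he5, mul_one, div_self (pow_ne_zero _ hd)])
    have hAS : ((A * S ^ m : GL3 K) : Matrix (Fin 3) (Fin 3) K) =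
        eigenMatrix (k / (d - b)) b d (d * ζ) := by
      have hS' : (S : Matrix (Fin 3) (Fin 3) K) = eigenMatrix (k / (d - b)) 1 1 ζ := by
        rw [hS, eigenMatrix]
        simp
      rw [Units.val_mul, Units.val_pow_eq_pow_val, hA', hS', eigenMatrix_pow, eigenMatrix_mul, hm]
      congr 1
      · simp
      · simp
      · field_simp
    have hζ5 := hζ.pow_eq_one
    obtain ⟨h5, -⟩ := pow_five_eq_of_orderOf_le hAS
      (hord _ (mul_mem hmem (pow_mem hSmem m))) (N := 30) (by norm_num)
      (by linear_combination congrArg (· ^ 5) hb6')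
      (by rw [mul_pow, show (30 : ℕ) = 5 * 6 by norm_num, pow_mul ζ, hζ5, one_pow, mul_one])
      (fun n _ hn => hζ.dvd_of_pow_eq_one n (mul_left_cancel₀ (pow_ne_zero n hd)
        (by rw [← mul_pow, hn, mul_one])))
    refine hbd (mul_left_cancel₀ (pow_ne_zero 5 hd) ?_)
    linear_combination hb6' - b * h5
  · have hb0 : b ≠ 0 := fun h0 => hc (by rw [← hbd5, h0]; ring)
    have hb5 : b ^ 5 = d ^ 5 := mul_left_cancel₀ hb0 (by rw [hbd5, ← hb6]; ring)
    have he5 : e ^ 5 = b * d ^ 4 := mul_left_cancel₀ hd (by rw [hde, ← hbd5]; ring)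
    have : Fact (Nat.Prime 5) := ⟨by norm_num⟩
    have hprim : IsPrimitiveRoot (b / d) 5 := by
      rw [← orderOf_eq_prime (x := b / d) (p := 5)
        (by rw [div_pow, hb5, div_self (pow_ne_zero _ hd)]) (by rwa [ne_eq, div_eq_one_iff_eq hd])]
      exact IsPrimitiveRoot.orderOf _
    obtain ⟨-, h5⟩ := pow_five_eq_of_orderOf_le hA' (hord _ hmem) (N := 25) (by norm_num)
      (by linear_combination congrArg (· ^ 5) hb5)
      (by
        calc e ^ 25 = (e ^ 5) ^ 5 := by ring
          _ = b ^ 5 * d ^ 20 := by rw [he5]; ring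
          _ = d ^ 25 := by rw [hb5]; ring)
      (fun n hn _ => hprim.dvd_of_pow_eq_one n (by
        rw [div_pow, hn, div_self (pow_ne_zero _ hd)]))
    exact hbd (mul_right_cancel₀ (pow_ne_zero 4 hd) (by rw [← he5, h5]; ring))

/-- For `L₆ ∈ K[X,Y]` homogeneous of degree `6` with `YZ⁵ + L₆(X,Y)` smooth and
all automorphisms of order at most `5`, the automorphism group is cyclic of order `5`,
generated by `diag(1, 1, ζ₅)`. -/
theorem typeFiveHomology_sextic_automorphisms {K : Type*} [Field K] [IsAlgClosed K] [CharZero K]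
    (ζ : K) (hζ : IsPrimitiveRoot ζ 5) (L : MvPolynomial (Fin 2) K)
    (hL : L.IsHomogeneous 6)
    (hsm : IsSmoothSextic (X 1 * X 2 ^ 5
      + rename (Fin.castSucc : Fin 2 → Fin 3) L : MvPolynomial (Fin 3) K))
    (hord : ∀ g ∈ planeAut (X 1 * X 2 ^ 5
      + rename (Fin.castSucc : Fin 2 → Fin 3) L : MvPolynomial (Fin 3) K), orderOf g ≤ 5) :
    planeAut (X 1 * X 2 ^ 5 + rename (Fin.castSucc : Fin 2 → Fin 3) L : MvPolynomial (Fin 3) K)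
      = Subgroup.zpowers (pgl !![1, 0, 0; 0, 1, 0; 0, 0, ζ]) ∧
    Nat.card ↥(planeAut (X 1 * X 2 ^ 5
      + rename (Fin.castSucc : Fin 2 → Fin 3) L : MvPolynomial (Fin 3) K)) = 5 := by
  have h5 := hζ.pow_eq_one
  have hunit : IsUnit (!![1, 0, 0; 0, 1, 0; 0, 0, ζ] : Matrix (Fin 3) (Fin 3) K) := by
    rw [Matrix.isUnit_iff_isUnit_det]
    simpa [Matrix.det_fin_three] using hζ.ne_zero (by norm_num)
  obtain ⟨S, hS⟩ := hunit
  rw [← hS, pgl_val]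
  have hSmem : (QuotientGroup.mk S : PGL3 K) ∈ planeAut (typeFiveSextic L) :=
    ⟨S, rfl, 1, one_ne_zero, by rw [hS, matAct_homology h5, one_smul]⟩
  have hS' : (S : Matrix (Fin 3) (Fin 3) K) = eigenMatrix 0 1 1 ζ := by simp [hS, eigenMatrix]
  have hSord : orderOf (QuotientGroup.mk S : PGL3 K) = 5 := by
    have : Fact (Nat.Prime 5) := ⟨by norm_num⟩
    refine orderOf_eq_prime ((mk_pow_eq_one_iff hS' 5).mpr (by simp [h5])) fun h1 => ?_
    rw [← pow_one (QuotientGroup.mk S : PGL3 K), mk_pow_eq_one_iff hS'] at h1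
    exact hζ.ne_one (by norm_num) (by simpa using h1.2)
  have hmain : planeAut (typeFiveSextic L) = Subgroup.zpowers (QuotientGroup.mk S : PGL3 K) := by
    refine le_antisymm ?_ (Subgroup.zpowers_le.mpr hSmem)
    rintro _ ⟨A, rfl, c, hc, h⟩
    have hshape := shape_of_matAct_eq_smul hL hsm A.mul_inv hc h
    have hbd := eigenvalues_eq_of_orderOf_le hζ hL hsm hord hS hSmem hshape hc h
    rw [← hbd] at hshape
    rw [hshape] at h
    obtain ⟨hb6, hbe⟩ := relations_of_matAct_eq_smul hL hsm h
    have hb : A.val 0 0 ≠ 0 := left_ne_zero_of_mul (hbe.trans_ne hc)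
    have hk := shear_eq_zero_of_matAct_eq_smul hL hsm hb h
    have he5 : A.val 2 2 ^ 5 = A.val 0 0 ^ 5 := mul_left_cancel₀ hb (by rw [hbe, ← hb6]; ring)
    obtain ⟨m, -, hm⟩ := hζ.eq_pow_of_pow_eq_one (ξ := A.val 2 2 / A.val 0 0)
      (by rw [div_pow, he5, div_self (pow_ne_zero _ hb)])
    refine Subgroup.mem_zpowers_iff.mpr ⟨m, ?_⟩
    rw [zpow_natCast, ← QuotientGroup.mk_pow]
    refine (mk_eq_mk_of_eq_smul (t := A.val 0 0) ?_).symm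
    rw [Units.val_pow_eq_pow_val, hS', eigenMatrix_pow, hm]
    conv_lhs => rw [hshape, hk]
    ext i j
    fin_cases i <;> fin_cases j <;> simp [eigenMatrix]
    field_simp
  refine ⟨hmain, ?_⟩
  rw [hmain, Nat.card_zpowers, hSord]
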